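/- For p, q ≥ 1 and symmetric kernels f on Z^p and g on Z^q, the canonical symmetrization of the tensor product f⊗g satisfies, for all z₁,…,z_{p+q}: (p+q)!·(f ⊗̃ g)(z₁,…,z_{p+q}) = p·(p+q−1)!·(f(z_{p+q},·) ⊗̃ g)(z₁,…,z_{p+q−1}) + q·(p+q−1)!·(f ⊗̃ g(z_{p+q},·))(z₁,…,z_{p+q−1}). -/

import Mathlib

open Finset

/-- Symmetrization of a kernel on `Z^k`. -/
noncomputable def symmetrize {Z : Type*} {k : ℕ} (h : (Fin k → Z) → ℝ) :
    (Fin k → Z) → ℝ :=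
  fun z => (1 / (Nat.factorial k : ℝ)) * ∑ π : Equiv.Perm (Fin k), h (z ∘ π)

/-- Tensor product of kernels: `(f ⊗ g)(z₁,…,z_{p+q}) = f(z₁,…,z_p) g(z_{p+1},…,z_{p+q})`. -/
def tensor {Z : Type*} {p q : ℕ} (f : (Fin p → Z) → ℝ) (g : (Fin q → Z) → ℝ) :
    (Fin (p + q) → Z) → ℝ :=
  fun z => f (fun i => z (Fin.castAdd q i)) * g (fun j => z (Fin.natAdd p j))

/-- A sum over permutations of `Fin (n + 1)`, organized by the preimage of the last element. -/
theorem sum_perm_comp_eq_sum_insertNth {Z : Type*} {n : ℕ} (F : (Fin (n + 1) → Z) → ℝ)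
    (z : Fin (n + 1) → Z) :
    ∑ π : Equiv.Perm (Fin (n + 1)), F (z ∘ π) =
      ∑ j : Fin (n + 1), ∑ σ : Equiv.Perm (Fin n),
        F (j.insertNth (z (Fin.last n)) ((z ∘ Fin.castSucc) ∘ σ)) := by
  rw [← Fintype.sum_prod_type' (f := fun (j : Fin (n + 1)) (σ : Equiv.Perm (Fin n)) =>
    F (j.insertNth (z (Fin.last n)) ((z ∘ Fin.castSucc) ∘ σ)))]
  let e : Fin (n + 1) × Equiv.Perm (Fin n) → Equiv.Perm (Fin (n + 1)) := fun x =>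
    ((finSuccEquiv' x.1).trans x.2.optionCongr).trans (finSuccEquiv' (Fin.last n)).symm
  have e_self (j σ) : e (j, σ) j = Fin.last n := by simp [e]
  have e_succAbove (j σ k) : e (j, σ) (j.succAbove k) = (σ k).castSucc := by simp [e]
  have he : Function.Bijective e := by
    rw [Fintype.bijective_iff_injective_and_card]
    refine ⟨?_, by simp [Fintype.card_perm, Nat.factorial_succ]⟩
    rintro ⟨j, σ⟩ ⟨j', σ'⟩ h
    obtain rfl : j = j' := (e (j, σ)).injective (by rw [e_self, h, e_self])
    congr 1
    ext k : 1
    apply Fin.castSucc_injective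
    rw [← e_succAbove j, ← e_succAbove j, h]
  refine (Fintype.sum_bijective e he _ _ fun ⟨j, σ⟩ => ?_).symm
  congr 1
  rw [Fin.insertNth_eq_iff]
  exact ⟨by simp [e_self], by ext k; simp [Fin.removeNth, e_succAbove]⟩

theorem sum_perm_comp_cast {Z : Type*} {m n : ℕ} (h : m = n) (F : (Fin m → Z) → ℝ)
    (w : Fin n → Z) :
    ∑ σ : Equiv.Perm (Fin n), F ((w ∘ σ) ∘ Fin.cast h) =
      ∑ σ : Equiv.Perm (Fin m), F ((w ∘ Fin.cast h) ∘ σ) := by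
  subst h
  rfl

theorem apply_insertNth_eq_apply_cons {Z : Type*} {n : ℕ} {f : (Fin (n + 1) → Z) → ℝ}
    (hf : ∀ (π : Equiv.Perm (Fin (n + 1))) (w : Fin (n + 1) → Z), f (w ∘ π) = f w)
    (i : Fin (n + 1)) (x : Z) (w : Fin n → Z) :
    f (i.insertNth x w) = f (Fin.cons x w) := by
  rw [← Fin.cons_comp_cycleRange, hf]

theorem tensor_insertNth_castAdd {Z : Type*} {p q : ℕ} {f : (Fin (p + 1) → Z) → ℝ}
    (hf : ∀ (π : Equiv.Perm (Fin (p + 1))) (w : Fin (p + 1) → Z), f (w ∘ π) = f w)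
    (g : (Fin (q + 1) → Z) → ℝ) (i : Fin (p + 1)) (x : Z) (w : Fin (p + 1 + q) → Z) :
    tensor f g (Fin.insertNth (n := p + 1 + q) (α := fun _ => Z) (Fin.castAdd (q + 1) i) x w) =
      tensor (fun v : Fin p → Z => f (Fin.cons x v)) g
        (w ∘ Fin.cast (show p + (q + 1) = p + 1 + q by omega)) := by
  unfold tensor
  congr 1
  · dsimp only
    rw [← apply_insertNth_eq_apply_cons hf i]
    congr 1
    symm
    rw [Fin.insertNth_eq_iff]
    refine ⟨by exact (Fin.insertNth_apply_same (α := fun _ => Z) _ _ _).symm, ?_⟩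
    ext k
    simp only [Fin.removeNth, Function.comp_apply]
    rw [← Fin.insertNth_apply_succAbove (α := fun _ => Z)
      (Fin.castAdd (q + 1) i : Fin (p + 1 + q + 1)) x w]
    congr 1
    ext
    grind [Fin.succAbove, Fin.lt_def, Fin.val_castAdd, Fin.val_natAdd]
  · congr 1
    ext k
    simp only [Function.comp_apply]
    rw [← Fin.insertNth_apply_succAbove (α := fun _ => Z)
      (Fin.castAdd (q + 1) i : Fin (p + 1 + q + 1)) x w]
    congr 1
    ext
    grind [Fin.succAbove, Fin.lt_def, Fin.val_castAdd, Fin.val_natAdd]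

theorem tensor_insertNth_natAdd {Z : Type*} {p q : ℕ} (f : (Fin (p + 1) → Z) → ℝ)
    {g : (Fin (q + 1) → Z) → ℝ}
    (hg : ∀ (π : Equiv.Perm (Fin (q + 1))) (w : Fin (q + 1) → Z), g (w ∘ π) = g w)
    (j : Fin (q + 1)) (x : Z) (w : Fin (p + 1 + q) → Z) :
    tensor f g (Fin.insertNth (n := p + 1 + q) (α := fun _ => Z) (Fin.natAdd (p + 1) j) x w) =
      tensor f (fun v : Fin q → Z => g (Fin.cons x v)) w := by
  unfold tensor
  congr 1
  · congr 1
    ext k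
    rw [← Fin.insertNth_apply_succAbove (α := fun _ => Z)
      (Fin.natAdd (p + 1) j : Fin (p + 1 + q + 1)) x w]
    congr 1
    ext
    grind [Fin.succAbove, Fin.lt_def, Fin.val_castAdd, Fin.val_natAdd]
  · dsimp only
    rw [← apply_insertNth_eq_apply_cons hg j]
    congr 1
    symm
    rw [Fin.insertNth_eq_iff]
    refine ⟨by exact (Fin.insertNth_apply_same (α := fun _ => Z) _ _ _).symm, ?_⟩
    ext k
    simp only [Fin.removeNth]
    rw [← Fin.insertNth_apply_succAbove (α := fun _ => Z)
      (Fin.natAdd (p + 1) j : Fin (p + 1 + q + 1)) x w]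
    congr 1
    ext
    grind [Fin.succAbove, Fin.lt_def, Fin.val_castAdd, Fin.val_natAdd]

theorem factorial_mul_symmetrize {Z : Type*} {k n : ℕ} (hn : n = k) (h : (Fin k → Z) → ℝ)
    (z : Fin k → Z) :
    (Nat.factorial n : ℝ) * symmetrize h z = ∑ π : Equiv.Perm (Fin k), h (z ∘ π) := by
  subst hn
  rw [symmetrize, ← mul_assoc, mul_one_div_cancel (by positivity), one_mul]

/-- Key combinatorial identity (c02) in the proof of Lemma 2.6: for symmetric kernels
`f` on `Z^{p+1}` and `g` on `Z^{q+1}`, writing `k = (p+1)+(q+1)`,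
`k! (f ⊗̃ g)(z₁,…,z_k) = (p+1)(k-1)! (f(z_k,·) ⊗̃ g)(z₁,…,z_{k-1})
  + (q+1)(k-1)! (f ⊗̃ g(z_k,·))(z₁,…,z_{k-1})`. -/
theorem symmetrized_tensor_recursion {Z : Type*} (p q : ℕ)
    (f : (Fin (p + 1) → Z) → ℝ) (g : (Fin (q + 1) → Z) → ℝ)
    (hf : ∀ (π : Equiv.Perm (Fin (p + 1))) (w : Fin (p + 1) → Z), f (w ∘ π) = f w)
    (hg : ∀ (π : Equiv.Perm (Fin (q + 1))) (w : Fin (q + 1) → Z), g (w ∘ π) = g w)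
    (z : Fin ((p + 1) + (q + 1)) → Z) :
    (Nat.factorial ((p + 1) + (q + 1)) : ℝ) * symmetrize (tensor f g) z
      = ((p : ℝ) + 1) * (Nat.factorial (p + q + 1) : ℝ) *
          symmetrize
            (tensor (fun w : Fin p → Z => f (Fin.cons (z (Fin.last _)) w)) g)
            (fun i : Fin (p + (q + 1)) => z (Fin.castLE (by omega) i))
        + ((q : ℝ) + 1) * (Nat.factorial (p + q + 1) : ℝ) *
          symmetrize
            (tensor f (fun w : Fin q → Z => g (Fin.cons (z (Fin.last _)) w)))
            (fun i : Fin ((p + 1) + q) => z (Fin.castLE (by omega) i)) := by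
  rw [mul_assoc, mul_assoc, factorial_mul_symmetrize rfl,
    factorial_mul_symmetrize (Nat.add_assoc p q 1),
    factorial_mul_symmetrize (Nat.add_right_comm p q 1)]
  refine (sum_perm_comp_eq_sum_insertNth (n := p + 1 + q) _ z).trans ?_
  refine (Fin.sum_univ_add (a := p + 1) (b := q + 1) _).trans ?_
  simp only [tensor_insertNth_castAdd hf, tensor_insertNth_natAdd f hg, sum_const, card_univ,
    Fintype.card_fin, nsmul_eq_mul, Nat.cast_add, Nat.cast_one]
  rw [sum_perm_comp_cast]
  rfl
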